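/- Let M be a proper Archimedean quadratic module of A. Then an algebra homomorphism α ∈ X(A) is continuous with respect to the topology induced by the seminorm ‖·‖_M if and only if α ∈ K(M); i.e., the Gelfand spectrum of (A, ‖·‖_M) equals K(M). -/

import Mathlib

/-!
Setting: `A` is a commutative unital `ℝ`-algebra.
`X(A)` is formalized as `A →ₐ[ℝ] ℝ`, with the topology induced from the
product topology on `A → ℝ`.
-/

/-- A cone of `A`: closed under addition and under scalar multiplication
by nonnegative reals. -/
def IsCone {A : Type*} [CommRing A] [Algebra ℝ A] (C : Set A) : Prop :=
  (∀ x ∈ C, ∀ y ∈ C, x + y ∈ C) ∧ ∀ r : ℝ, 0 ≤ r → ∀ x ∈ C, r • x ∈ C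

/-- A quadratic module of `A`: a cone containing `0` and `1`, closed under
multiplication by squares. -/
def IsQuadraticModule {A : Type*} [CommRing A] [Algebra ℝ A] (M : Set A) : Prop :=
  IsCone M ∧ (0 : A) ∈ M ∧ (1 : A) ∈ M ∧ ∀ a : A, ∀ m ∈ M, a ^ 2 * m ∈ M

/-- A cone `C` is Archimedean if for every `a ∈ A` there is a real `r ≥ 0`
with `r + a ∈ C` and `r - a ∈ C`. -/
def IsArchimedeanCone {A : Type*} [CommRing A] [Algebra ℝ A] (C : Set A) : Prop :=
  ∀ a : A, ∃ r : ℝ, 0 ≤ r ∧ algebraMap ℝ A r + a ∈ C ∧ algebraMap ℝ A r - a ∈ C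

/-- The seminorm `‖a‖_M = inf {r ∈ ℝ : r + a ∈ M and r - a ∈ M}` associated with
an (Archimedean) quadratic module `M`. -/
noncomputable def mNorm {A : Type*} [CommRing A] [Algebra ℝ A] (M : Set A) (a : A) : ℝ :=
  sInf {r : ℝ | algebraMap ℝ A r + a ∈ M ∧ algebraMap ℝ A r - a ∈ M}

/-- The topology on `A` induced by a seminorm `ρ`, generated by the open balls. -/
def seminormTopology {A : Type*} [CommRing A] [Algebra ℝ A] (ρ : A → ℝ) :
    TopologicalSpace A :=
  TopologicalSpace.generateFrom
    {U : Set A | ∃ a : A, ∃ ε : ℝ, 0 < ε ∧ U = {x : A | ρ (x - a) < ε}}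

/-- The topology on the real character space `X(A) = A →ₐ[ℝ] ℝ`, induced from the
product topology on `ℝ^A`. -/
noncomputable instance XATop {A : Type*} [CommRing A] [Algebra ℝ A] :
    TopologicalSpace (A →ₐ[ℝ] ℝ) :=
  TopologicalSpace.induced (fun α => (α : A → ℝ)) Pi.topologicalSpace

section QuadraticModule

variable {A : Type*} [CommRing A] [Algebra ℝ A] {M : Set A}

lemma IsQuadraticModule.algebraMap_mem (hM : IsQuadraticModule M) {r : ℝ} (hr : 0 ≤ r) :
    algebraMap ℝ A r ∈ M := by
  rw [Algebra.algebraMap_eq_smul_one]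
  exact hM.1.2 r hr 1 hM.2.2.1

lemma IsQuadraticModule.nonneg_of_algebraMap_mem (hM : IsQuadraticModule M)
    (hproper : (-1 : A) ∉ M) {r : ℝ} (hr : algebraMap ℝ A r ∈ M) : 0 ≤ r := by
  by_contra! h
  apply hproper
  have key := hM.1.2 (-r)⁻¹ (inv_nonneg.2 (by linarith)) _ hr
  rwa [Algebra.smul_def, ← map_mul, inv_neg, neg_mul, inv_mul_cancel₀ h.ne, map_neg,
    map_one] at key

lemma IsQuadraticModule.nonneg_of_mem_of_mem (hM : IsQuadraticModule M)
    (hproper : (-1 : A) ∉ M) {a : A} {r : ℝ} (h₁ : algebraMap ℝ A r + a ∈ M)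
    (h₂ : algebraMap ℝ A r - a ∈ M) : 0 ≤ r := by
  have h := hM.1.1 _ h₁ _ h₂
  rw [add_add_sub_cancel, ← map_add] at h
  linarith [hM.nonneg_of_algebraMap_mem hproper h]

lemma IsQuadraticModule.mNorm_le (hM : IsQuadraticModule M) (hproper : (-1 : A) ∉ M) {a : A}
    {r : ℝ} (h₁ : algebraMap ℝ A r + a ∈ M) (h₂ : algebraMap ℝ A r - a ∈ M) :
    mNorm M a ≤ r :=
  csInf_le ⟨0, fun _ hs => hM.nonneg_of_mem_of_mem hproper hs.1 hs.2⟩ ⟨h₁, h₂⟩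

lemma IsArchimedeanCone.exists_lt_of_mNorm_lt (harch : IsArchimedeanCone M) {a : A} {ε : ℝ}
    (h : mNorm M a < ε) :
    ∃ r < ε, algebraMap ℝ A r + a ∈ M ∧ algebraMap ℝ A r - a ∈ M := by
  obtain ⟨r, -, hr⟩ := harch a
  obtain ⟨s, hs, hsε⟩ := exists_lt_of_csInf_lt ⟨r, hr⟩ h
  exact ⟨s, hsε, hs⟩

lemma IsQuadraticModule.exists_mNorm_lt_subset (hM : IsQuadraticModule M)
    (harch : IsArchimedeanCone M) (hproper : (-1 : A) ∉ M) {U : Set A}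
    (hU : (seminormTopology (mNorm M)).IsOpen U) (h0 : (0 : A) ∈ U) :
    ∃ δ > 0, ∀ x, mNorm M x < δ → x ∈ U := by
  induction hU with
  | basic U hU =>
    obtain ⟨a, ε, -, rfl⟩ := hU
    obtain ⟨s, hs, hs₁, hs₂⟩ := harch.exists_lt_of_mNorm_lt h0
    refine ⟨ε - s, by linarith, fun x hx => ?_⟩
    obtain ⟨r, hr, hr₁, hr₂⟩ := harch.exists_lt_of_mNorm_lt hx
    refine (hM.mNorm_le hproper (r := r + s) ?_ ?_).trans_lt (by linarith)
    · convert hM.1.1 _ hr₁ _ hs₁ using 1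
      rw [map_add]; ring
    · convert hM.1.1 _ hr₂ _ hs₂ using 1
      rw [map_add]; ring
  | univ => exact ⟨1, one_pos, fun _ _ => trivial⟩
  | inter s t _ _ ihs iht =>
    obtain ⟨δ, hδ, h⟩ := ihs h0.1
    obtain ⟨η, hη, h'⟩ := iht h0.2
    exact ⟨min δ η, lt_min hδ hη, fun x hx =>
      ⟨h x (hx.trans_le (min_le_left _ _)), h' x (hx.trans_le (min_le_right _ _))⟩⟩
  | sUnion S _ ih =>
    obtain ⟨t, ht, h0t⟩ := h0
    obtain ⟨δ, hδ, h⟩ := ih t ht h0t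
    exact ⟨δ, hδ, fun x hx => ⟨t, ht, h x hx⟩⟩

lemma IsQuadraticModule.one_sub_sq_mem (hM : IsQuadraticModule M) {s : A}
    (h₁ : 1 + s ∈ M) (h₂ : 1 - s ∈ M) : 1 - s ^ 2 ∈ M := by
  have h := hM.1.2 2⁻¹ (by norm_num) _
    (hM.1.1 _ (hM.2.2.2 (1 + s) _ h₂) _ (hM.2.2.2 (1 - s) _ h₁))
  have e : (1 + s) ^ 2 * (1 - s) + (1 - s) ^ 2 * (1 + s) = (2 : ℝ) • (1 - s ^ 2) := by
    rw [two_smul]; ring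
  rwa [e, inv_smul_smul₀ two_ne_zero] at h

lemma IsQuadraticModule.one_sub_sq_pow_mem (hM : IsQuadraticModule M) {s : A}
    (h : 1 - s ^ 2 ∈ M) (k : ℕ) : 1 - (s ^ 2) ^ k ∈ M := by
  induction k with
  | zero => simpa using hM.2.1
  | succ k ih =>
    convert hM.1.1 _ h _ (hM.2.2.2 s _ ih) using 1
    ring

lemma IsQuadraticModule.mNorm_smul_sq_pow_le (hM : IsQuadraticModule M)
    (hproper : (-1 : A) ∉ M) {s : A} (h : 1 - s ^ 2 ∈ M) {r : ℝ} (hr : 0 ≤ r) (k : ℕ) :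
    mNorm M (r • (s ^ 2) ^ k) ≤ r := by
  have hsq : (s ^ 2) ^ k ∈ M := by
    simpa [← pow_mul, mul_comm] using hM.2.2.2 (s ^ k) 1 hM.2.2.1
  refine hM.mNorm_le hproper (hM.1.1 _ (hM.algebraMap_mem hr) _ (hM.1.2 r hr _ hsq)) ?_
  have h' := hM.1.2 r hr _ (hM.one_sub_sq_pow_mem h k)
  rwa [smul_sub, ← Algebra.algebraMap_eq_smul_one] at h'

lemma abs_le_mNorm (harch : IsArchimedeanCone M) {α : A →ₐ[ℝ] ℝ}
    (hα : ∀ m ∈ M, 0 ≤ α m) (a : A) : |α a| ≤ mNorm M a := by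
  obtain ⟨r, -, hr⟩ := harch a
  refine le_csInf ⟨r, hr⟩ fun s hs => abs_le.2 ?_
  have h₁ := hα _ hs.1
  have h₂ := hα _ hs.2
  simp only [map_add, map_sub, AlgHom.commutes, Algebra.algebraMap_self, RingHom.id_apply]
    at h₁ h₂
  constructor <;> linarith

end QuadraticModule

/-- For a proper Archimedean quadratic module `M`, a character
`α ∈ X(A)` is continuous with respect to the `‖·‖_M`-topology if and only if
`α ∈ K(M)`; i.e. `Sp_{‖·‖_M}(A) = K(M)`. -/
theorem gelfandSpectrum_mNorm_eq_KM {A : Type*} [CommRing A] [Algebra ℝ A]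
    (M : Set A) (hM : IsQuadraticModule M) (harch : IsArchimedeanCone M)
    (hproper : (-1 : A) ∉ M) (α : A →ₐ[ℝ] ℝ) :
    @Continuous A ℝ (seminormTopology (mNorm M)) _ ⇑α ↔ ∀ m ∈ M, 0 ≤ α m := by
  let : TopologicalSpace A := seminormTopology (mNorm M)
  constructor
  · intro hα m hm
    by_contra! hneg
    obtain ⟨δ, hδ, hball⟩ := hM.exists_mNorm_lt_subset harch hproper
      ((Metric.isOpen_ball (x := (0 : ℝ)) (ε := 1)).preimage hα) (by simp)
    obtain ⟨N, hN, -, hNm⟩ := harch m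
    have hN' : 0 < N + 1 := by linarith
    set c : ℝ := 2 / (N + 1) with hc
    have hcpos : 0 < c := by positivity
    set s : A := 1 - c • m with hs
    have h₁ : 1 + s ∈ M := by
      have h := hM.1.2 c hcpos.le _ (hM.1.1 _ hNm _ hM.2.2.1)
      have e : c • (algebraMap ℝ A N - m + 1) = 1 + s := by
        have : algebraMap ℝ A N + 1 = (N + 1) • (1 : A) := by
          rw [add_smul, one_smul, Algebra.algebraMap_eq_smul_one]
        rw [sub_add_eq_add_sub, this, smul_sub, smul_smul, hc, div_mul_cancel₀ _ hN'.ne',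
          two_smul, hs]
        ring
      rwa [e] at h
    have h₂ : 1 - s ∈ M := by
      simpa [hs] using hM.1.2 c hcpos.le m hm
    have hαs : 1 < α s ^ 2 := by
      have : α s = 1 - c * α m := by simp [hs]
      nlinarith [mul_neg_of_pos_of_neg hcpos hneg]
    obtain ⟨k, hk⟩ := pow_unbounded_of_one_lt (2 / δ) hαs
    have hx := hball _ ((hM.mNorm_smul_sq_pow_le hproper (hM.one_sub_sq_mem h₁ h₂)
      (half_pos hδ).le k).trans_lt (half_lt_self hδ))
    simp only [Set.mem_preimage, map_smul, map_pow, smul_eq_mul, mem_ball_zero_iff,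
      Real.norm_eq_abs] at hx
    have hlt := (le_abs_self _).trans_lt hx
    rw [div_lt_iff₀ hδ] at hk
    linarith
  · intro hα
    refine continuous_iff_continuousAt.2 fun a => Metric.tendsto_nhds.2 fun ε hε => ?_
    have hopen : IsOpen {x : A | mNorm M (x - a) < ε} :=
      TopologicalSpace.isOpen_generateFrom_of_mem ⟨a, ε, hε, rfl⟩
    have hmem : mNorm M (a - a) < ε := by
      refine (hM.mNorm_le hproper (r := 0) ?_ ?_).trans_lt hε <;> simpa using hM.2.1
    filter_upwards [hopen.mem_nhds hmem] with x hx
    rw [Real.dist_eq, ← map_sub]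
    exact (abs_le_mNorm harch hα _).trans_lt hx
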